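/- Fix q > 2, δ > 1 and ε ∈ (0, 1). Let p_G be a probability measure on ℝ with p_G({0}) = 0, let G have law p_G with 0 < E|G|^{2q−2} < ∞, let B be a random variable with law p_B = (1 − ε)δ₀ + ε·p_G (δ₀ the point mass at 0), and let Z be a standard Gaussian random variable independent of B. Suppose that for each σ > 0 there is given τ(σ) > 0 satisfying τ(σ)² = σ² + (1/δ)·inf_{α ≥ 0} E(η_q(B + τ(σ)·Z; α·τ(σ)^{2−q}) − B)², with the infimum attained at some α(σ) ≥ 0, and set AMSE(σ) := δ·(τ(σ)² − σ²). Then (AMSE(σ) − σ²/(1 − 1/δ)) / σ⁴ → −δ³·ε·(q−1)²·(E|G|^{q−2})² / ((δ−1)³·E|G|^{2q−2}) as σ → 0⁺. -/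

import Mathlib

open MeasureTheory ProbabilityTheory Filter

/-- The proximal operator `η_q(u; χ)`, i.e. the (unique, for `q ≥ 1`, `χ > 0`) global
minimizer over `z ∈ ℝ` of `z ↦ (1/2)(u − z)² + χ|z|^q`. -/
noncomputable def prox (q χ u : ℝ) : ℝ :=
  Classical.epsilon fun z : ℝ =>
    ∀ w : ℝ, (1 / 2) * (u - z) ^ 2 + χ * |z| ^ q ≤ (1 / 2) * (u - w) ^ 2 + χ * |w| ^ q

/-- The law `p_B = (1 − ε)·δ₀ + ε·p_G` of the signal coordinates. -/
noncomputable def mixLaw (ε : ℝ) (pG : Measure ℝ) : Measure ℝ :=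
  (ENNReal.ofReal (1 - ε)) • Measure.dirac (0 : ℝ) + (ENNReal.ofReal ε) • pG

/-- The mean square error `E(η_q(B + τZ; α·τ^{2−q}) − B)²`, with `B ∼ p_B` and `Z`
standard Gaussian independent of `B`. -/
noncomputable def mse (q : ℝ) (pB : Measure ℝ) (α τ : ℝ) : ℝ :=
  ∫ b, ∫ z, (prox q (α * τ ^ (2 - q)) (b + τ * z) - b) ^ 2 ∂(gaussianReal 0 1) ∂pB

/-- The odd power function `x ↦ |x|^(q-1) sign x`. -/
noncomputable def signedPow (q x : ℝ) : ℝ := |x| ^ (q - 2) * x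

lemma abs_signedPow {q : ℝ} (hq : 2 < q) (x : ℝ) : |signedPow q x| = |x| ^ (q - 1) := by
  rw [signedPow, abs_mul, abs_of_nonneg (Real.rpow_nonneg (abs_nonneg x) _),
    ← Real.rpow_add_one' (abs_nonneg x) (by linarith)]
  congr 1
  ring

lemma signedPow_neg (q x : ℝ) : signedPow q (-x) = -signedPow q x := by
  simp [signedPow]

lemma signedPow_sq {q : ℝ} (hq : 2 < q) (x : ℝ) :
    signedPow q x ^ 2 = |x| ^ (2 * q - 2) := by
  rw [← sq_abs, abs_signedPow hq, ← Real.rpow_mul_natCast (abs_nonneg x)]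
  congr 1
  push_cast
  ring

lemma hasDerivAt_signedPow {q : ℝ} (hq : 2 < q) (x : ℝ) :
    HasDerivAt (signedPow q) ((q - 1) * |x| ^ (q - 2)) x := by
  rcases eq_or_ne x 0 with rfl | hx
  · have h0 : (0 : ℝ) ^ (q - 2) = 0 := Real.zero_rpow (by linarith)
    rw [abs_zero, h0, mul_zero, hasDerivAt_iff_tendsto_slope]
    have hc : Continuous fun y : ℝ => |y| ^ (q - 2) :=
      continuous_abs.rpow_const fun _ => Or.inr (by linarith)
    have ht : Tendsto (fun y : ℝ => |y| ^ (q - 2)) (nhdsWithin 0 {0}ᶜ) (nhds 0) := by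
      have := (hc.tendsto 0).mono_left (nhdsWithin_le_nhds (s := {0}ᶜ))
      simpa [h0] using this
    refine ht.congr' ?_
    filter_upwards [self_mem_nhdsWithin] with y hy
    have hy : y ≠ 0 := hy
    simp [slope_def_field, signedPow, hy]
  · have h1 := ((hasDerivAt_abs hx).rpow_const (p := q - 2)
      (Or.inl (abs_ne_zero.mpr hx))).mul (hasDerivAt_id x)
    refine h1.congr_deriv ?_
    have h2 : |x| ^ (q - 2 - 1) * |x| = |x| ^ (q - 2) := by
      rw [← Real.rpow_add_one (abs_ne_zero.mpr hx)]
      congr 1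
      ring
    have h3 : (SignType.sign x : ℝ) * x = |x| := sign_mul_self x
    simp only [id]
    linear_combination (q - 2) * |x| ^ (q - 2 - 1) * h3 + (q - 2) * h2

lemma continuous_signedPow {q : ℝ} (hq : 2 < q) : Continuous (signedPow q) :=
  continuous_iff_continuousAt.mpr fun x => (hasDerivAt_signedPow hq x).continuousAt

lemma hasStrictDerivAt_signedPow {q : ℝ} (hq : 2 < q) (x : ℝ) :
    HasStrictDerivAt (signedPow q) ((q - 1) * |x| ^ (q - 2)) x := by
  have hc : Continuous fun y : ℝ => (q - 1) * |y| ^ (q - 2) :=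
    continuous_const.mul (continuous_abs.rpow_const fun _ => Or.inr (by linarith))
  exact hasStrictDerivAt_of_hasDerivAt_of_continuousAt
    (Eventually.of_forall fun y => hasDerivAt_signedPow hq y) hc.continuousAt

lemma monotone_signedPow {q : ℝ} (hq : 2 < q) : Monotone (signedPow q) := by
  refine monotone_of_hasDerivAt_nonneg (fun x => hasDerivAt_signedPow hq x) fun x => ?_
  exact mul_nonneg (by linarith) (Real.rpow_nonneg (abs_nonneg x) _)

lemma abs_signedPow_sub_le {q : ℝ} (hq : 2 < q) {x y M : ℝ} (hx : |x| ≤ M) (hy : |y| ≤ M) :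
    |signedPow q x - signedPow q y| ≤ (q - 1) * M ^ (q - 2) * |x - y| := by
  refine Convex.norm_image_sub_le_of_norm_hasDerivWithin_le (s := Set.Icc (-M) M)
    (fun z _ => (hasDerivAt_signedPow hq z).hasDerivWithinAt) (fun z hz => ?_)
    (convex_Icc _ _) (abs_le.mp hy) (abs_le.mp hx)
  rw [Real.norm_eq_abs, abs_of_nonneg (mul_nonneg (by linarith)
    (Real.rpow_nonneg (abs_nonneg z) _))]
  have := Real.rpow_le_rpow (abs_nonneg z) (abs_le.mpr hz) (show 0 ≤ q - 2 by linarith)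
  exact mul_le_mul_of_nonneg_left this (by linarith)

lemma prox_add_mul_signedPow {q χ : ℝ} (hq : 2 < q) (hχ : 0 ≤ χ) (u : ℝ) :
    prox q χ u + χ * q * signedPow q (prox q χ u) = u := by
  have hex : ∃ z : ℝ, ∀ w : ℝ,
      (1 / 2) * (u - z) ^ 2 + χ * |z| ^ q ≤ (1 / 2) * (u - w) ^ 2 + χ * |w| ^ q := by
    refine Continuous.exists_forall_le
      (f := fun z : ℝ => (1 / 2) * (u - z) ^ 2 + χ * |z| ^ q) ?_ ?_
    · have : Continuous fun z : ℝ => |z| ^ q :=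
        continuous_abs.rpow_const fun _ => Or.inr (by linarith)
      fun_prop
    · have h1 : Tendsto (fun z : ℝ => ‖z‖ - (|u| + 1 / 2)) (cocompact ℝ) atTop :=
        tendsto_atTop_add_const_right _ _ (tendsto_norm_cocompact_atTop)
      refine tendsto_atTop_mono (fun z => ?_) h1
      have h2 : 0 ≤ χ * |z| ^ q := mul_nonneg hχ (Real.rpow_nonneg (abs_nonneg z) _)
      have h3 : |z| - |u| ≤ |u - z| := by
        rw [abs_sub_comm]
        exact abs_sub_abs_le_abs_sub z u
      rw [Real.norm_eq_abs]
      nlinarith [sq_nonneg (|u - z| - 1), sq_abs (u - z)]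
  have hmin := Classical.epsilon_spec hex
  change ∀ w : ℝ, (1 / 2) * (u - prox q χ u) ^ 2 + χ * |prox q χ u| ^ q ≤ _ at hmin
  set z := prox q χ u
  have hd : HasDerivAt (fun z : ℝ => (1 / 2) * (u - z) ^ 2 + χ * |z| ^ q)
      ((1 / 2) * ((2 : ℕ) * (u - z) ^ (2 - 1) * (-1)) + χ * (q * |z| ^ (q - 2) * z)) z :=
    ((((hasDerivAt_id z).const_sub u).pow 2).const_mul (1 / 2)).add
      ((hasDerivAt_abs_rpow z (by linarith)).const_mul χ)
  have h0 := IsLocalMin.hasDerivAt_eq_zero (Eventually.of_forall hmin) hd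
  rw [signedPow]
  norm_num at h0
  linarith

section Shrink

variable {q : ℝ}

/-- Solutions of `x + s ψ(x) = u` depend on `u` in a nonexpansive way. -/
lemma abs_sub_le_of_add_mul_signedPow (hq : 2 < q) {s x y u v : ℝ} (hs : 0 ≤ s)
    (hx : x + s * signedPow q x = u) (hy : y + s * signedPow q y = v) :
    |x - y| ≤ |u - v| := by
  have hm : 0 ≤ (signedPow q x - signedPow q y) * (x - y) := by
    rcases le_total x y with h | h
    · exact mul_nonneg_of_nonpos_of_nonpos (sub_nonpos.mpr (monotone_signedPow hq h))
        (sub_nonpos.mpr h)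
    · exact mul_nonneg (sub_nonneg.mpr (monotone_signedPow hq h)) (sub_nonneg.mpr h)
  refine sq_le_sq.mp ?_
  subst hx hy
  nlinarith [mul_nonneg hs hm, sq_nonneg (s * (signedPow q x - signedPow q y))]

lemma abs_le_of_add_mul_signedPow (hq : 2 < q) {s x u : ℝ} (hs : 0 ≤ s)
    (hx : x + s * signedPow q x = u) : |x| ≤ |u| := by
  have := abs_sub_le_of_add_mul_signedPow hq hs hx (y := 0) (v := 0) (by simp [signedPow])
  simpa using this

lemma mul_signedPow_le_of_nonneg (hq : 2 < q) {s t x y u : ℝ} (hs : 0 ≤ s) (hst : s ≤ t)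
    (hx0 : 0 ≤ x) (hx : x + s * signedPow q x = u) (hy : y + t * signedPow q y = u) :
    s * signedPow q x ≤ t * signedPow q y := by
  by_contra! h
  have hxy : x ≤ y := by linarith
  have h1 := monotone_signedPow hq hxy
  have h2 : 0 ≤ signedPow q x := mul_nonneg (Real.rpow_nonneg (abs_nonneg x) _) hx0
  nlinarith [mul_le_mul_of_nonneg_left h1 (hs.trans hst), mul_le_mul_of_nonneg_right hst h2]

/-- The amount of shrinkage increases with the shrinkage parameter. -/
lemma sq_mul_signedPow_le (hq : 2 < q) {s t x y u : ℝ} (hs : 0 ≤ s) (hst : s ≤ t)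
    (hx : x + s * signedPow q x = u) (hy : y + t * signedPow q y = u) :
    (s * signedPow q x) ^ 2 ≤ (t * signedPow q y) ^ 2 := by
  rcases le_total 0 x with h | h
  · have h2 : 0 ≤ signedPow q x := mul_nonneg (Real.rpow_nonneg (abs_nonneg x) _) h
    exact pow_le_pow_left₀ (mul_nonneg hs h2) (mul_signedPow_le_of_nonneg hq hs hst h hx hy) 2
  · have h' : 0 ≤ -x := by linarith
    have h2 : 0 ≤ signedPow q (-x) := mul_nonneg (Real.rpow_nonneg (abs_nonneg _) _) h'
    have h3 := mul_signedPow_le_of_nonneg hq hs hst h' (u := -u) (y := -y)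
      (by rw [signedPow_neg]; linarith) (by rw [signedPow_neg]; linarith)
    have h4 := pow_le_pow_left₀ (mul_nonneg hs h2) h3 2
    simpa [signedPow_neg] using h4

end Shrink

/-- The proximal operator parametrised by `s = q χ`. -/
noncomputable def shrink (q s u : ℝ) : ℝ := prox q (s / q) u

section Shrink

variable {q : ℝ}

lemma shrink_spec (hq : 2 < q) {s : ℝ} (hs : 0 ≤ s) (u : ℝ) :
    shrink q s u + s * signedPow q (shrink q s u) = u := by
  have := prox_add_mul_signedPow hq (div_nonneg hs (by linarith : (0 : ℝ) ≤ q)) u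
  rwa [div_mul_cancel₀ _ (by linarith : q ≠ 0)] at this

lemma abs_shrink_sub_le (hq : 2 < q) {s : ℝ} (hs : 0 ≤ s) (u v : ℝ) :
    |shrink q s u - shrink q s v| ≤ |u - v| :=
  abs_sub_le_of_add_mul_signedPow hq hs (shrink_spec hq hs u) (shrink_spec hq hs v)

lemma abs_shrink_le (hq : 2 < q) {s : ℝ} (hs : 0 ≤ s) (u : ℝ) : |shrink q s u| ≤ |u| :=
  abs_le_of_add_mul_signedPow hq hs (shrink_spec hq hs u)

lemma abs_signedPow_shrink_le (hq : 2 < q) {s : ℝ} (hs : 0 ≤ s) (u : ℝ) :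
    |signedPow q (shrink q s u)| ≤ |u| ^ (q - 1) := by
  rw [abs_signedPow hq]
  exact Real.rpow_le_rpow (abs_nonneg _) (abs_shrink_le hq hs u) (by linarith)

lemma continuous_shrink (hq : 2 < q) {s : ℝ} (hs : 0 ≤ s) : Continuous (shrink q s) := by
  have : LipschitzWith 1 (shrink q s) := LipschitzWith.of_dist_le_mul fun u v => by
    simpa [Real.dist_eq] using abs_shrink_sub_le hq hs u v
  exact this.continuous

lemma shrink_ne_zero (hq : 2 < q) {s u : ℝ} (hs : 0 ≤ s) (hu : u ≠ 0) : shrink q s u ≠ 0 := by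
  intro h
  have := shrink_spec hq hs u
  simp [h, signedPow] at this
  exact hu this.symm

lemma tendsto_shrink {ι : Type*} {l : Filter ι} (hq : 2 < q) {s u : ι → ℝ} {b : ℝ}
    (hs0 : ∀ᶠ i in l, 0 ≤ s i) (hs : Tendsto s l (nhds 0)) (hu : Tendsto u l (nhds b)) :
    Tendsto (fun i => shrink q (s i) (u i)) l (nhds b) := by
  have h1 : Tendsto (fun i => s i * |u i| ^ (q - 1)) l (nhds 0) := by
    have := hs.mul (hu.abs.rpow_const (p := q - 1) (Or.inr (by linarith)))
    simpa using this
  have h2 : Tendsto (fun i => shrink q (s i) (u i) - u i) l (nhds 0) := by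
    refine squeeze_zero_norm' ?_ h1
    filter_upwards [hs0] with i hi
    have e : shrink q (s i) (u i) - u i = -(s i * signedPow q (shrink q (s i) (u i))) := by
      linarith [shrink_spec hq hi (u i)]
    rw [e, Real.norm_eq_abs, abs_neg, abs_mul, abs_of_nonneg hi]
    exact mul_le_mul_of_nonneg_left (abs_signedPow_shrink_le hq hi _) hi
  simpa using h2.add hu

/-- Differentiation of `ψ ∘ shrink` along a vanishing perturbation, uniformly in a vanishing
shrinkage parameter. -/
lemma tendsto_signedPow_shrink_slope {ι : Type*} {l : Filter ι} (hq : 2 < q) {s τ : ι → ℝ}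
    (hs0 : ∀ᶠ i in l, 0 ≤ s i) (hs : Tendsto s l (nhds 0))
    (hτ0 : ∀ᶠ i in l, 0 < τ i) (hτ : Tendsto τ l (nhds 0)) (b z : ℝ) :
    Tendsto (fun i => (signedPow q (shrink q (s i) (b + τ i * z)) -
      signedPow q (shrink q (s i) b)) / τ i) l (nhds ((q - 1) * |b| ^ (q - 2) * z)) := by
  have hu : Tendsto (fun i => b + τ i * z) l (nhds b) := by
    simpa using (hτ.mul_const z).const_add b
  have hx := tendsto_shrink hq hs0 hs hu
  have hy := tendsto_shrink hq hs0 hs (tendsto_const_nhds (x := b))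
  set x : ι → ℝ := fun i => shrink q (s i) (b + τ i * z) with hxdef
  set y : ι → ℝ := fun i => shrink q (s i) b with hydef
  have hxy : ∀ᶠ i in l, |x i - y i| ≤ τ i * |z| := by
    filter_upwards [hs0, hτ0] with i hi hti
    have := abs_shrink_sub_le hq hi (b + τ i * z) b
    simpa [abs_mul, abs_of_pos hti] using this
  have hlo : (fun i => signedPow q (x i) - signedPow q (y i) -
      (q - 1) * |b| ^ (q - 2) * (x i - y i)) =o[l] τ := by
    have h1 := (hasStrictDerivAt_signedPow hq b).hasStrictFDerivAt.isLittleO.comp_tendsto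
      (hx.prodMk_nhds hy)
    have h2 : (fun i => x i - y i) =O[l] τ := by
      refine Asymptotics.IsBigO.of_bound |z| ?_
      filter_upwards [hxy, hτ0] with i hi hti
      rw [Real.norm_eq_abs, Real.norm_eq_abs, abs_of_pos hti]
      linarith
    have h3 := h1.trans_isBigO h2
    refine h3.congr_left fun i => ?_
    simp [mul_comm]
  have hdiff : Tendsto (fun i => (x i - y i) / τ i) l (nhds z) := by
    set C := (q - 1) * (|b| + |z|) ^ (q - 2)
    have hb : Tendsto (fun i => s i * (C * |z|)) l (nhds 0) := by
      simpa using hs.mul_const (C * |z|)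
    have h1 : Tendsto (fun i => (x i - y i) / τ i - z) l (nhds 0) := by
      refine squeeze_zero_norm' ?_ hb
      filter_upwards [hs0, hτ0, hxy, hτ.eventually_le_const (zero_lt_one)] with i hi hti hxyi hti1
      have e1 := shrink_spec hq hi (b + τ i * z)
      have e2 := shrink_spec hq hi b
      have e : (x i - y i) / τ i - z =
          -(s i * ((signedPow q (x i) - signedPow q (y i)) / τ i)) := by
        field_simp
        simp only [hxdef, hydef]
        linarith
      have hxb : |x i| ≤ |b| + |z| := by
        refine (abs_shrink_le hq hi _).trans ((abs_add_le _ _).trans ?_)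
        rw [abs_mul, abs_of_pos hti]
        nlinarith [abs_nonneg z]
      have hyb : |y i| ≤ |b| + |z| :=
        (abs_shrink_le hq hi _).trans (by linarith [abs_nonneg z])
      have hL := abs_signedPow_sub_le hq hxb hyb
      have hC : 0 ≤ C := mul_nonneg (by linarith)
        (Real.rpow_nonneg (add_nonneg (abs_nonneg b) (abs_nonneg z)) _)
      rw [e, Real.norm_eq_abs, abs_neg, abs_mul, abs_of_nonneg hi, abs_div, abs_of_pos hti]
      refine mul_le_mul_of_nonneg_left ?_ hi
      rw [div_le_iff₀ hti]
      calc _ ≤ C * |x i - y i| := hL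
        _ ≤ C * (τ i * |z|) := mul_le_mul_of_nonneg_left hxyi hC
        _ = _ := by ring
    simpa using h1.add_const z
  have h := hlo.tendsto_div_nhds_zero.add (hdiff.const_mul ((q - 1) * |b| ^ (q - 2)))
  rw [zero_add] at h
  refine h.congr fun i => ?_
  ring

end Shrink

section Moments

variable {q : ℝ} {pB : Measure ℝ} [IsProbabilityMeasure pB]

lemma integrable_envelope (hq : 2 < q) (hB : Integrable (fun x => |x| ^ (2 * q - 2)) pB) :
    Integrable (fun p : ℝ × ℝ => (1 + |p.1| + |p.2|) ^ (2 * q - 2))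
      (pB.prod (gaussianReal 0 1)) := by
  have hr : 0 < 2 * q - 2 := by linarith
  have hr0 : ENNReal.ofReal (2 * q - 2) ≠ 0 := by simpa using hr
  have hrt : ENNReal.ofReal (2 * q - 2) ≠ ⊤ := ENNReal.ofReal_ne_top
  have hm : MemLp (fun x : ℝ => x) (ENNReal.ofReal (2 * q - 2)) pB := by
    rw [← integrable_norm_rpow_iff (by fun_prop) hr0 hrt, ENNReal.toReal_ofReal hr.le]
    exact hB
  have hg : MemLp (fun x : ℝ => x) (ENNReal.ofReal (2 * q - 2)) (gaussianReal 0 1) :=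
    memLp_id_gaussianReal' _ hrt
  have h1 : MemLp (fun p : ℝ × ℝ => |p.1|) (ENNReal.ofReal (2 * q - 2))
      (pB.prod (gaussianReal 0 1)) := (hm.comp_fst _).norm
  have h2 : MemLp (fun p : ℝ × ℝ => |p.2|) (ENNReal.ofReal (2 * q - 2))
      (pB.prod (gaussianReal 0 1)) := (hg.comp_snd _).norm
  have h0 : MemLp (fun _ : ℝ × ℝ => (1 : ℝ)) (ENNReal.ofReal (2 * q - 2))
      (pB.prod (gaussianReal 0 1)) := memLp_const 1
  have hW : MemLp (fun p : ℝ × ℝ => 1 + |p.1| + |p.2|) (ENNReal.ofReal (2 * q - 2))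
      (pB.prod (gaussianReal 0 1)) := (h0.add h1).add h2
  have := hW.integrable_norm_rpow hr0 hrt
  rw [ENNReal.toReal_ofReal hr.le] at this
  refine this.congr (Eventually.of_forall fun p => ?_)
  have : 0 ≤ 1 + |p.1| + |p.2| := by positivity
  simp only [Real.norm_eq_abs, abs_of_nonneg this]

lemma abs_signedPow_shrink_le_envelope (hq : 2 < q) {s τ : ℝ} (hs : 0 ≤ s) (hτ : 0 ≤ τ)
    (hτ1 : τ ≤ 1) (p : ℝ × ℝ) :
    |signedPow q (shrink q s (p.1 + τ * p.2))| ≤ (1 + |p.1| + |p.2|) ^ (q - 1) := by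
  refine (abs_signedPow_shrink_le hq hs _).trans
    (Real.rpow_le_rpow (abs_nonneg _) ((abs_add_le _ _).trans ?_) (by linarith))
  rw [abs_mul, abs_of_nonneg hτ]
  nlinarith [abs_nonneg p.2]

lemma sq_signedPow_shrink_le_envelope (hq : 2 < q) {s τ : ℝ} (hs : 0 ≤ s) (hτ : 0 ≤ τ)
    (hτ1 : τ ≤ 1) (p : ℝ × ℝ) :
    signedPow q (shrink q s (p.1 + τ * p.2)) ^ 2 ≤ (1 + |p.1| + |p.2|) ^ (2 * q - 2) := by
  have hW : 0 ≤ 1 + |p.1| + |p.2| := by positivity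
  have h := pow_le_pow_left₀ (abs_nonneg _) (abs_signedPow_shrink_le_envelope hq hs hτ hτ1 p) 2
  rw [sq_abs, ← Real.rpow_mul_natCast hW] at h
  refine h.trans_eq ?_
  congr 1
  push_cast
  ring

lemma sq_snd_le_envelope (hq : 2 < q) (p : ℝ × ℝ) :
    p.2 ^ 2 ≤ (1 + |p.1| + |p.2|) ^ (2 * q - 2) := by
  have hW : 1 ≤ 1 + |p.1| + |p.2| := by linarith [abs_nonneg p.1, abs_nonneg p.2]
  calc p.2 ^ 2 = |p.2| ^ 2 := (sq_abs _).symm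
    _ ≤ (1 + |p.1| + |p.2|) ^ 2 :=
      pow_le_pow_left₀ (abs_nonneg _) (by linarith [abs_nonneg p.1]) 2
    _ = (1 + |p.1| + |p.2|) ^ (2 : ℝ) := (Real.rpow_two _).symm
    _ ≤ _ := Real.rpow_le_rpow_of_exponent_le hW (by linarith)

lemma continuous_signedPow_shrink (hq : 2 < q) {s : ℝ} (hs : 0 ≤ s) (τ : ℝ) :
    Continuous fun p : ℝ × ℝ => signedPow q (shrink q s (p.1 + τ * p.2)) :=
  (continuous_signedPow hq).comp ((continuous_shrink hq hs).comp (by fun_prop))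

lemma integrable_sq_snd (hq : 2 < q) (hB : Integrable (fun x => |x| ^ (2 * q - 2)) pB) :
    Integrable (fun p : ℝ × ℝ => p.2 ^ 2) (pB.prod (gaussianReal 0 1)) :=
  (integrable_envelope hq hB).mono' (by fun_prop) (Eventually.of_forall fun p => by
    simpa using sq_snd_le_envelope hq p)

lemma integrable_sq_signedPow_shrink (hq : 2 < q)
    (hB : Integrable (fun x => |x| ^ (2 * q - 2)) pB) {s τ : ℝ} (hs : 0 ≤ s) (hτ : 0 ≤ τ)
    (hτ1 : τ ≤ 1) :
    Integrable (fun p : ℝ × ℝ => signedPow q (shrink q s (p.1 + τ * p.2)) ^ 2)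
      (pB.prod (gaussianReal 0 1)) :=
  (integrable_envelope hq hB).mono'
    ((continuous_signedPow_shrink hq hs τ).pow 2).aestronglyMeasurable
    (Eventually.of_forall fun p => by
      simpa using sq_signedPow_shrink_le_envelope hq hs hτ hτ1 p)

lemma integrable_snd_mul_signedPow_shrink (hq : 2 < q)
    (hB : Integrable (fun x => |x| ^ (2 * q - 2)) pB) {s τ : ℝ} (hs : 0 ≤ s) (hτ : 0 ≤ τ)
    (hτ1 : τ ≤ 1) :
    Integrable (fun p : ℝ × ℝ => p.2 * signedPow q (shrink q s (p.1 + τ * p.2)))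
      (pB.prod (gaussianReal 0 1)) :=
  (integrable_envelope hq hB).mono'
    (continuous_snd.mul (continuous_signedPow_shrink hq hs τ)).aestronglyMeasurable
    (Eventually.of_forall fun p => by
      have h1 := sq_signedPow_shrink_le_envelope hq hs hτ hτ1 p
      have h2 := sq_snd_le_envelope hq p
      rw [Real.norm_eq_abs, abs_le]
      constructor <;>
      nlinarith [sq_nonneg (p.2 - signedPow q (shrink q s (p.1 + τ * p.2))),
        sq_nonneg (p.2 + signedPow q (shrink q s (p.1 + τ * p.2)))])

lemma integral_sq_snd : ∫ p : ℝ × ℝ, p.2 ^ 2 ∂(pB.prod (gaussianReal 0 1)) = 1 := by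
  rw [integral_fun_snd (fun z : ℝ => z ^ 2)]
  have h := variance_eq_integral (μ := gaussianReal 0 1) (X := id) aemeasurable_id
  simp only [variance_id_gaussianReal, id, integral_id_gaussianReal, sub_zero] at h
  simp [← h]

lemma integral_sq_sub (hq : 2 < q)
    (hB : Integrable (fun x => |x| ^ (2 * q - 2)) pB) {s τ : ℝ} (hs : 0 ≤ s) (hτ : 0 ≤ τ)
    (hτ1 : τ ≤ 1) (a : ℝ) :
    Integrable (fun p : ℝ × ℝ => (a * p.2 - s * signedPow q (shrink q s (p.1 + τ * p.2))) ^ 2)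
      (pB.prod (gaussianReal 0 1)) ∧
    ∫ p : ℝ × ℝ, (a * p.2 - s * signedPow q (shrink q s (p.1 + τ * p.2))) ^ 2
        ∂(pB.prod (gaussianReal 0 1)) =
      a ^ 2 - 2 * a * s * (∫ p : ℝ × ℝ, p.2 * signedPow q (shrink q s (p.1 + τ * p.2))
        ∂(pB.prod (gaussianReal 0 1))) +
      s ^ 2 * ∫ p : ℝ × ℝ, signedPow q (shrink q s (p.1 + τ * p.2)) ^ 2
        ∂(pB.prod (gaussianReal 0 1)) := by
  have e : (fun p : ℝ × ℝ => (a * p.2 - s * signedPow q (shrink q s (p.1 + τ * p.2))) ^ 2) =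
      fun p => a ^ 2 * p.2 ^ 2 -
        2 * a * s * (p.2 * signedPow q (shrink q s (p.1 + τ * p.2))) +
        s ^ 2 * signedPow q (shrink q s (p.1 + τ * p.2)) ^ 2 := by
    ext p
    ring
  have h1 := (integrable_sq_snd hq hB).const_mul (a ^ 2)
  have h2 := (integrable_snd_mul_signedPow_shrink hq hB hs hτ hτ1).const_mul (2 * a * s)
  have h3 := (integrable_sq_signedPow_shrink hq hB hs hτ hτ1).const_mul (s ^ 2)
  rw [e]
  refine ⟨(h1.sub h2).add h3, ?_⟩
  refine (integral_add (h1.sub h2) h3).trans ?_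
  congr 1
  · refine (integral_sub h1 h2).trans ?_
    rw [integral_const_mul, integral_const_mul, integral_sq_snd, mul_one]
  · exact integral_const_mul _ _

lemma mse_eq (hq : 2 < q) (hB : Integrable (fun x => |x| ^ (2 * q - 2)) pB) {s τ α : ℝ}
    (hs : 0 ≤ s) (hτ : 0 ≤ τ) (hτ1 : τ ≤ 1) (hα : α * τ ^ (2 - q) = s / q) :
    mse q pB α τ =
      τ ^ 2 - 2 * τ * s * (∫ p : ℝ × ℝ, p.2 * signedPow q (shrink q s (p.1 + τ * p.2))
        ∂(pB.prod (gaussianReal 0 1))) +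
      s ^ 2 * ∫ p : ℝ × ℝ, signedPow q (shrink q s (p.1 + τ * p.2)) ^ 2
        ∂(pB.prod (gaussianReal 0 1)) := by
  obtain ⟨hi, he⟩ := integral_sq_sub hq hB hs hτ hτ1 τ
  rw [← he, integral_prod _ hi, mse, hα]
  refine integral_congr_ae (Eventually.of_forall fun b => ?_)
  refine integral_congr_ae (Eventually.of_forall fun z => ?_)
  change (shrink q s (b + τ * z) - b) ^ 2 = (τ * z - s * _) ^ 2
  congr 1
  linarith [shrink_spec hq hs (b + τ * z)]

variable {ι : Type*} {l : Filter ι} [l.IsCountablyGenerated] {s τ : ι → ℝ}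

lemma tendsto_integral_sq_signedPow_shrink (hq : 2 < q)
    (hB : Integrable (fun x => |x| ^ (2 * q - 2)) pB)
    (hs0 : ∀ᶠ i in l, 0 ≤ s i) (hτ0 : ∀ᶠ i in l, 0 < τ i) (hτ : Tendsto τ l (nhds 0))
    {h : ℝ → ℝ} (hlim : ∀ b z : ℝ,
      Tendsto (fun i => shrink q (s i) (b + τ i * z)) l (nhds (h b))) :
    Tendsto (fun i => ∫ p : ℝ × ℝ, signedPow q (shrink q (s i) (p.1 + τ i * p.2)) ^ 2
      ∂(pB.prod (gaussianReal 0 1))) l (nhds (∫ b, signedPow q (h b) ^ 2 ∂pB)) := by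
  have e : ∫ b, signedPow q (h b) ^ 2 ∂pB =
      ∫ p : ℝ × ℝ, signedPow q (h p.1) ^ 2 ∂(pB.prod (gaussianReal 0 1)) := by
    rw [integral_fun_fst (fun b : ℝ => signedPow q (h b) ^ 2)]
    simp
  rw [e]
  refine tendsto_integral_filter_of_dominated_convergence
    (fun p => (1 + |p.1| + |p.2|) ^ (2 * q - 2)) ?_ ?_ (integrable_envelope hq hB) ?_
  · filter_upwards [hs0] with i hi
    exact ((continuous_signedPow_shrink hq hi _).pow 2).aestronglyMeasurable
  · filter_upwards [hs0, hτ0, hτ.eventually_le_const zero_lt_one] with i hi hti hti1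
    refine Eventually.of_forall fun p => ?_
    simpa using sq_signedPow_shrink_le_envelope hq hi hti.le hti1 p
  · refine Eventually.of_forall fun p => ?_
    exact (((continuous_signedPow hq).tendsto _).comp (hlim p.1 p.2)).pow 2

lemma tendsto_integral_snd_mul_signedPow_shrink (hq : 2 < q)
    (hB : Integrable (fun x => |x| ^ (2 * q - 2)) pB)
    (hs0 : ∀ᶠ i in l, 0 ≤ s i) (hs : Tendsto s l (nhds 0))
    (hτ0 : ∀ᶠ i in l, 0 < τ i) (hτ : Tendsto τ l (nhds 0)) :
    Tendsto (fun i => (∫ p : ℝ × ℝ, p.2 * signedPow q (shrink q (s i) (p.1 + τ i * p.2))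
      ∂(pB.prod (gaussianReal 0 1))) / τ i) l (nhds ((q - 1) * ∫ b, |b| ^ (q - 2) ∂pB)) := by
  have e : (q - 1) * ∫ b, |b| ^ (q - 2) ∂pB =
      ∫ p : ℝ × ℝ, p.2 * ((q - 1) * |p.1| ^ (q - 2) * p.2)
        ∂(pB.prod (gaussianReal 0 1)) := by
    have h1 : (fun p : ℝ × ℝ => p.2 * ((q - 1) * |p.1| ^ (q - 2) * p.2)) =
        fun p => ((q - 1) * |p.1| ^ (q - 2)) * p.2 ^ 2 := by
      ext p
      ring
    have h2 : ∫ z : ℝ, z ^ 2 ∂(gaussianReal 0 1) = 1 := by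
      have := integral_sq_snd (pB := pB)
      rwa [integral_fun_snd (fun z : ℝ => z ^ 2), probReal_univ, one_smul] at this
    rw [h1, integral_prod_mul (fun b : ℝ => (q - 1) * |b| ^ (q - 2)) (fun z : ℝ => z ^ 2), h2,
      mul_one, integral_const_mul]
  have hlim : Tendsto (fun i => ∫ p : ℝ × ℝ,
      p.2 * ((signedPow q (shrink q (s i) (p.1 + τ i * p.2)) -
        signedPow q (shrink q (s i) p.1)) / τ i) ∂(pB.prod (gaussianReal 0 1))) l
      (nhds (∫ p : ℝ × ℝ, p.2 * ((q - 1) * |p.1| ^ (q - 2) * p.2)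
        ∂(pB.prod (gaussianReal 0 1)))) := by
    refine tendsto_integral_filter_of_dominated_convergence
      (fun p => (q - 1) * (1 + |p.1| + |p.2|) ^ (2 * q - 2)) ?_ ?_
      ((integrable_envelope hq hB).const_mul _) ?_
    · filter_upwards [hs0] with i hi
      have h1 := continuous_signedPow_shrink hq hi (τ i)
      have h2 : Continuous fun p : ℝ × ℝ => signedPow q (shrink q (s i) p.1) :=
        (continuous_signedPow hq).comp ((continuous_shrink hq hi).comp continuous_fst)
      exact (continuous_snd.mul ((h1.sub h2).div_const _)).aestronglyMeasurable
    · filter_upwards [hs0, hτ0, hτ.eventually_le_const zero_lt_one] with i hi hti hti1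
      refine Eventually.of_forall fun p => ?_
      set W := 1 + |p.1| + |p.2|
      have hW : 1 ≤ W := by linarith [abs_nonneg p.1, abs_nonneg p.2]
      have hx : |shrink q (s i) (p.1 + τ i * p.2)| ≤ W := by
        refine (abs_shrink_le hq hi _).trans ((abs_add_le _ _).trans ?_)
        rw [abs_mul, abs_of_pos hti]
        nlinarith [abs_nonneg p.2]
      have hy : |shrink q (s i) p.1| ≤ W :=
        (abs_shrink_le hq hi _).trans (by linarith [abs_nonneg p.2])
      have hL := abs_signedPow_sub_le hq hx hy
      have hd : |shrink q (s i) (p.1 + τ i * p.2) - shrink q (s i) p.1| ≤ τ i * |p.2| := by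
        have := abs_shrink_sub_le hq hi (p.1 + τ i * p.2) p.1
        simpa [abs_mul, abs_of_pos hti] using this
      have hC : 0 ≤ (q - 1) * W ^ (q - 2) :=
        mul_nonneg (by linarith) (Real.rpow_nonneg (by linarith) _)
      rw [Real.norm_eq_abs, abs_mul, abs_div, abs_of_pos hti]
      have h1 : |signedPow q (shrink q (s i) (p.1 + τ i * p.2)) -
          signedPow q (shrink q (s i) p.1)| / τ i ≤ (q - 1) * W ^ (q - 2) * |p.2| := by
        rw [div_le_iff₀ hti]
        calc _ ≤ _ := hL
          _ ≤ _ := mul_le_mul_of_nonneg_left hd hC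
          _ = _ := by ring
      have h2 : |p.2| ≤ W := by linarith [abs_nonneg p.1]
      calc _ ≤ |p.2| * ((q - 1) * W ^ (q - 2) * |p.2|) :=
            mul_le_mul_of_nonneg_left h1 (abs_nonneg _)
        _ = (q - 1) * W ^ (q - 2) * |p.2| ^ 2 := by ring
        _ ≤ (q - 1) * W ^ (q - 2) * W ^ 2 :=
            mul_le_mul_of_nonneg_left (pow_le_pow_left₀ (abs_nonneg _) h2 2) hC
        _ = (q - 1) * W ^ q := by
            rw [mul_assoc, ← Real.rpow_two, ← Real.rpow_add (by linarith)]
            congr 2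
            ring
        _ ≤ (q - 1) * W ^ (2 * q - 2) :=
            mul_le_mul_of_nonneg_left (Real.rpow_le_rpow_of_exponent_le hW (by linarith))
              (by linarith)
    · refine Eventually.of_forall fun p => ?_
      exact (tendsto_signedPow_shrink_slope hq hs0 hs hτ0 hτ p.1 p.2).const_mul p.2
  rw [e]
  refine hlim.congr' ?_
  filter_upwards [hs0, hτ0, hτ.eventually_le_const zero_lt_one] with i hi hti hti1
  have hz : ∫ p : ℝ × ℝ, signedPow q (shrink q (s i) p.1) * p.2
      ∂(pB.prod (gaussianReal 0 1)) = 0 := by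
    rw [integral_prod_mul (fun b : ℝ => signedPow q (shrink q (s i) b)) (fun z : ℝ => z),
      integral_id_gaussianReal, mul_zero]
  have h1 := integrable_snd_mul_signedPow_shrink hq hB hi hti.le hti1
  have h0 := integrable_snd_mul_signedPow_shrink hq hB hi le_rfl zero_le_one
  have h0' : Integrable (fun p : ℝ × ℝ => signedPow q (shrink q (s i) p.1) * p.2)
      (pB.prod (gaussianReal 0 1)) :=
    h0.congr (Eventually.of_forall fun p => by simp [mul_comm])
  have h2 := integral_sub h1 h0'
  rw [hz, sub_zero] at h2
  rw [← h2, ← integral_div]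
  refine integral_congr_ae (Eventually.of_forall fun p => ?_)
  simp only
  ring

lemma tendsto_zero_of_sq_mul_integral_le (hq : 2 < q)
    (hB : Integrable (fun x => |x| ^ (2 * q - 2)) pB) (hB0 : pB {0}ᶜ ≠ 0)
    (hs0 : ∀ᶠ i in l, 0 ≤ s i) (hτ0 : ∀ᶠ i in l, 0 < τ i) (hτ : Tendsto τ l (nhds 0))
    (hle : ∀ᶠ i in l, s i ^ 2 * ∫ p : ℝ × ℝ, signedPow q (shrink q (s i) (p.1 + τ i * p.2)) ^ 2
      ∂(pB.prod (gaussianReal 0 1)) ≤ 4 * τ i ^ 2) :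
    Tendsto s l (nhds 0) := by
  rw [tendsto_order]
  refine ⟨fun a ha => hs0.mono fun i hi => ha.trans_le hi, fun e he => ?_⟩
  have hlim := tendsto_integral_sq_signedPow_shrink (s := fun _ : ι => e) (h := shrink q e) hq hB
    (Eventually.of_forall fun _ => he.le) hτ0 hτ fun b z => by
      have : Tendsto (fun i => b + τ i * z) l (nhds b) := by
        simpa using (hτ.mul_const z).const_add b
      exact ((continuous_shrink hq he.le).tendsto b).comp this
  have hK : 0 < ∫ b, signedPow q (shrink q e b) ^ 2 ∂pB := by
    have hi : Integrable (fun b => signedPow q (shrink q e b) ^ 2) pB := by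
      refine hB.mono' (((continuous_signedPow hq).comp
        (continuous_shrink hq he.le)).pow 2).aestronglyMeasurable (Eventually.of_forall fun b => ?_)
      rw [Real.norm_eq_abs, abs_of_nonneg (sq_nonneg _), signedPow_sq hq]
      exact Real.rpow_le_rpow (abs_nonneg _) (abs_shrink_le hq he.le b) (by linarith)
    rw [integral_pos_iff_support_of_nonneg (fun b => sq_nonneg _) hi]
    refine (pos_iff_ne_zero.mpr hB0).trans_le (measure_mono fun b hb => ?_)
    have h1 := shrink_ne_zero hq he.le (u := b) hb
    simp only [Function.mem_support, signedPow]
    positivity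
  have h2 : Tendsto (fun i => 4 * τ i ^ 2) l (nhds 0) := by
    simpa using (hτ.pow 2).const_mul 4
  have h3 := h2.eventually_lt (hlim.const_mul (e ^ 2)) (by positivity)
  filter_upwards [hs0, hτ0, hτ.eventually_le_const zero_lt_one, hle, h3] with i hi hti hti1 hlei h3i
  by_contra! hei
  refine absurd (h3i.trans_le ?_) hlei.not_gt
  rw [← integral_const_mul, ← integral_const_mul]
  refine integral_mono
    ((integrable_sq_signedPow_shrink hq hB he.le hti.le hti1).const_mul _)
    ((integrable_sq_signedPow_shrink hq hB hi hti.le hti1).const_mul _) fun p => ?_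
  have := sq_mul_signedPow_le hq he.le hei (shrink_spec hq he.le (p.1 + τ i * p.2))
    (shrink_spec hq hi (p.1 + τ i * p.2))
  simpa only [mul_pow] using this

end Moments

lemma mse_nonneg (q : ℝ) (pB : Measure ℝ) (α τ : ℝ) : 0 ≤ mse q pB α τ :=
  integral_nonneg fun _ => integral_nonneg fun _ => sq_nonneg _

lemma mse_zero {q : ℝ} (hq : 2 < q) (pB : Measure ℝ) [IsProbabilityMeasure pB] (τ : ℝ) :
    mse q pB 0 τ = τ ^ 2 := by
  have h2 : ∫ z : ℝ, z ^ 2 ∂(gaussianReal 0 1) = 1 := by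
    have := integral_sq_snd (pB := pB)
    rwa [integral_fun_snd (fun z : ℝ => z ^ 2), probReal_univ, one_smul] at this
  have hp : ∀ u, prox q 0 u = u := fun u => by
    simpa using prox_add_mul_signedPow hq le_rfl u
  simp only [mse, zero_mul, hp, add_sub_cancel_left, mul_pow]
  rw [integral_const_mul, h2]
  simp

section Mixture

variable {ε : ℝ} {pG : Measure ℝ}

lemma isProbabilityMeasure_mixLaw [IsProbabilityMeasure pG] (hε : ε ∈ Set.Ioo (0 : ℝ) 1) :
    IsProbabilityMeasure (mixLaw ε pG) := by
  constructor
  simp only [mixLaw, Measure.add_apply, Measure.smul_apply, measure_univ, smul_eq_mul, mul_one]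
  rw [← ENNReal.ofReal_add (by linarith [hε.2]) hε.1.le]
  simp

lemma integrable_mixLaw {f : ℝ → ℝ} (hf : Integrable f pG) :
    Integrable f (mixLaw ε pG) := by
  refine Integrable.add_measure ?_ (hf.smul_measure ENNReal.ofReal_ne_top)
  exact (integrable_dirac (by simp)).smul_measure ENNReal.ofReal_ne_top

lemma integral_mixLaw (hε : ε ∈ Set.Ioo (0 : ℝ) 1) {f : ℝ → ℝ} (hf : Integrable f pG)
    (hf0 : f 0 = 0) : ∫ x, f x ∂(mixLaw ε pG) = ε * ∫ x, f x ∂pG := by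
  rw [mixLaw, integral_add_measure
    ((integrable_dirac (by simp)).smul_measure ENNReal.ofReal_ne_top)
    (hf.smul_measure ENNReal.ofReal_ne_top), integral_smul_measure, integral_smul_measure,
    integral_dirac, hf0, ENNReal.toReal_ofReal hε.1.le]
  simp

lemma mixLaw_compl_zero_ne_zero [IsProbabilityMeasure pG]
    (hε : ε ∈ Set.Ioo (0 : ℝ) 1) (hG0 : pG {0} = 0) :
    mixLaw ε pG {0}ᶜ ≠ 0 := by
  have h1 : pG {0}ᶜ = 1 := (prob_compl_eq_one_iff (measurableSet_singleton 0)).mpr hG0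
  simp [mixLaw, h1, hε.1]

end Mixture

lemma integrable_abs_rpow_of_le {μ : Measure ℝ} [IsFiniteMeasure μ] {r r' : ℝ} (hr : 0 ≤ r)
    (hrr' : r ≤ r') (h : Integrable (fun x => |x| ^ r') μ) :
    Integrable (fun x => |x| ^ r) μ := by
  refine ((integrable_const 1).add h).mono'
    (continuous_abs.rpow_const fun _ => Or.inr hr).aestronglyMeasurable
    (Eventually.of_forall fun x => ?_)
  have h0 := Real.rpow_nonneg (abs_nonneg x) r'
  rw [Real.norm_eq_abs, abs_of_nonneg (Real.rpow_nonneg (abs_nonneg x) _), Pi.add_apply]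
  rcases le_total |x| 1 with hx | hx
  · linarith [Real.rpow_le_one (abs_nonneg x) hx hr]
  · linarith [Real.rpow_le_rpow_of_exponent_le hx hrr']

/-- Second order expansion of the minimal mean square error as the noise level vanishes. -/
lemma tendsto_min_mse_sub_sq_div {q : ℝ} {pB : Measure ℝ} [IsProbabilityMeasure pB]
    {ι : Type*} {l : Filter ι} [l.IsCountablyGenerated] {τ α : ι → ℝ} (hq : 2 < q)
    (hB : Integrable (fun x => |x| ^ (2 * q - 2)) pB) (hB0 : pB {0}ᶜ ≠ 0)
    (hd : 0 < ∫ x, |x| ^ (2 * q - 2) ∂pB)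
    (hτ0 : ∀ᶠ i in l, 0 < τ i) (hτ : Tendsto τ l (nhds 0)) (hα : ∀ᶠ i in l, 0 ≤ α i)
    (hmin : ∀ᶠ i in l, ∀ β, 0 ≤ β → mse q pB (α i) (τ i) ≤ mse q pB β (τ i)) :
    Tendsto (fun i => (mse q pB (α i) (τ i) - τ i ^ 2) / τ i ^ 4) l
      (nhds (-(((q - 1) * ∫ x, |x| ^ (q - 2) ∂pB) ^ 2 / ∫ x, |x| ^ (2 * q - 2) ∂pB))) := by
  have hq0 : 0 < q := by linarith
  have hτ1 : ∀ᶠ i in l, τ i ≤ 1 := hτ.eventually_le_const zero_lt_one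
  have hu : ∀ b z : ℝ, Tendsto (fun i => b + τ i * z) l (nhds b) := fun b z => by
    simpa using (hτ.mul_const z).const_add b
  have hsq : ∫ b, signedPow q b ^ 2 ∂pB = ∫ x, |x| ^ (2 * q - 2) ∂pB := by
    simp only [signedPow_sq hq]
  set a := (q - 1) * ∫ x, |x| ^ (q - 2) ∂pB
  set d := ∫ x, |x| ^ (2 * q - 2) ∂pB
  set A : (ι → ℝ) → ι → ℝ := fun s i =>
    (∫ p : ℝ × ℝ, p.2 * signedPow q (shrink q (s i) (p.1 + τ i * p.2))
      ∂(pB.prod (gaussianReal 0 1)))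
  set D : (ι → ℝ) → ι → ℝ := fun s i =>
    (∫ p : ℝ × ℝ, signedPow q (shrink q (s i) (p.1 + τ i * p.2)) ^ 2
      ∂(pB.prod (gaussianReal 0 1)))
  have hAlim : ∀ s : ι → ℝ, (∀ᶠ i in l, 0 ≤ s i) → Tendsto s l (nhds 0) →
      Tendsto (fun i => A s i / τ i) l (nhds a) := fun s hs0 hs =>
    tendsto_integral_snd_mul_signedPow_shrink hq hB hs0 hs hτ0 hτ
  have hDlim : ∀ s : ι → ℝ, (∀ᶠ i in l, 0 ≤ s i) → Tendsto s l (nhds 0) →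
      Tendsto (D s) l (nhds d) := fun s hs0 hs => by
    rw [← hsq]
    exact tendsto_integral_sq_signedPow_shrink (h := fun b => b) hq hB hs0 hτ0 hτ
      fun b z => tendsto_shrink hq hs0 hs (hu b z)
  set s : ι → ℝ := fun i => q * (α i * τ i ^ (2 - q)) with hsdef
  have hs0 : ∀ᶠ i in l, 0 ≤ s i := by
    filter_upwards [hτ0, hα] with i hi hai
    exact mul_nonneg hq0.le (mul_nonneg hai (Real.rpow_nonneg hi.le _))
  have hms : ∀ᶠ i in l, mse q pB (α i) (τ i) =
      τ i ^ 2 - 2 * τ i * s i * A s i + s i ^ 2 * D s i := by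
    filter_upwards [hτ0, hτ1, hs0] with i hi hi1 hsi
    refine mse_eq hq hB hsi hi.le hi1 ?_
    simp only [hsdef]
    field_simp
  have hle : ∀ᶠ i in l, s i ^ 2 * D s i ≤ 4 * τ i ^ 2 := by
    filter_upwards [hτ0, hτ1, hs0, hms, hmin] with i hi hi1 hsi hmi hmini
    have h1 := hmini 0 le_rfl
    rw [mse_zero hq, hmi] at h1
    have h2 := (integral_sq_sub hq hB hsi hi.le hi1 (2 * τ i)).2
    have h3 : 0 ≤ (2 * τ i) ^ 2 - 2 * (2 * τ i) * s i * A s i + s i ^ 2 * D s i := by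
      rw [← h2]
      exact integral_nonneg fun _ => sq_nonneg _
    nlinarith
  have hs := tendsto_zero_of_sq_mul_integral_le hq hB hB0 hs0 hτ0 hτ hle
  set t : ι → ℝ := fun i => a / d * τ i ^ 2 with htdef
  have ha : 0 ≤ a := mul_nonneg (by linarith)
    (integral_nonneg fun x => Real.rpow_nonneg (abs_nonneg x) _)
  have ht0 : ∀ᶠ i in l, 0 ≤ t i :=
    Eventually.of_forall fun i => mul_nonneg (div_nonneg ha hd.le) (sq_nonneg _)
  have ht : Tendsto t l (nhds 0) := by
    simpa using (hτ.pow 2).const_mul (a / d)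
  have hlow : Tendsto (fun i => -((A s i / τ i) ^ 2 / D s i)) l (nhds (-(a ^ 2 / d))) :=
    (((hAlim s hs0 hs).pow 2).div (hDlim s hs0 hs) hd.ne').neg
  have hupp : Tendsto (fun i => -(2 * (a / d) * (A t i / τ i)) + (a / d) ^ 2 * D t i) l
      (nhds (-(a ^ 2 / d))) := by
    have h := (((hAlim t ht0 ht).const_mul (2 * (a / d))).neg).add
      ((hDlim t ht0 ht).const_mul ((a / d) ^ 2))
    convert h using 2
    field_simp
    ring
  refine tendsto_of_tendsto_of_tendsto_of_le_of_le' hlow hupp ?_ ?_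
  · filter_upwards [hτ0, hms, (hDlim s hs0 hs).eventually_const_lt hd] with i hi hmi hDi
    rw [hmi, le_div_iff₀ (by positivity)]
    have e : -((A s i / τ i) ^ 2 / D s i) * τ i ^ 4 = -(τ i ^ 2 * A s i ^ 2 / D s i) := by
      field_simp
    have e2 : τ i ^ 2 - 2 * τ i * s i * A s i + s i ^ 2 * D s i - τ i ^ 2 +
        τ i ^ 2 * A s i ^ 2 / D s i = (s i * D s i - τ i * A s i) ^ 2 / D s i := by
      field_simp
      ring
    have e3 : 0 ≤ (s i * D s i - τ i * A s i) ^ 2 / D s i := by positivity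
    rw [e]
    linarith
  · filter_upwards [hτ0, hτ1, hmin, ht0] with i hi hi1 hmini hti
    rw [div_le_iff₀ (by positivity)]
    have hpow : 0 < τ i ^ (2 - q) := Real.rpow_pos_of_pos hi _
    have h1 := hmini (t i / q / τ i ^ (2 - q)) (by positivity)
    rw [mse_eq hq hB hti hi.le hi1 (div_mul_cancel₀ _ hpow.ne') (α := _)] at h1
    change _ ≤ τ i ^ 2 - 2 * τ i * t i * A t i + t i ^ 2 * D t i at h1
    have e : (-(2 * (a / d) * (A t i / τ i)) + (a / d) ^ 2 * D t i) * τ i ^ 4 =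
        - 2 * τ i * t i * A t i + t i ^ 2 * D t i := by
      simp only [htdef]
      field_simp
    rw [e]
    linarith

/-- **small noise expansion, `q > 2`.** Let `q > 2`, `δ > 1`,
`ε ∈ (0,1)`, `p_G({0}) = 0`, `0 < E|G|^{2q−2} < ∞`, and suppose for each `σ > 0` the
number `τ(σ) > 0` satisfies the state-evolution fixed-point equation
`τ(σ)² = σ² + (1/δ)·inf_{α ≥ 0} E(η_q(B + τ(σ)Z; α τ(σ)^{2−q}) − B)²` with the infimum
attained. Then `AMSE(σ) = δ(τ(σ)² − σ²)` satisfies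
`(AMSE(σ) − σ²/(1 − 1/δ))/σ⁴ → −δ³ε(q−1)²(E|G|^{q−2})² / ((δ−1)³·E|G|^{2q−2})`
as `σ → 0⁺`. -/
theorem stmt_19 (q δ ε : ℝ) (hq : 2 < q) (hδ : 1 < δ) (hε : ε ∈ Set.Ioo (0 : ℝ) 1)
    (pG : Measure ℝ) [IsProbabilityMeasure pG] (hG0 : pG {0} = 0)
    (hInt : Integrable (fun x => |x| ^ (2 * q - 2)) pG)
    (hpos : 0 < ∫ x, |x| ^ (2 * q - 2) ∂pG)
    (τ : ℝ → ℝ) (hτpos : ∀ σ : ℝ, 0 < σ → 0 < τ σ)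
    (hfix : ∀ σ : ℝ, 0 < σ →
      (τ σ) ^ 2 = σ ^ 2 + (1 / δ) *
        sInf ((fun α : ℝ => mse q (mixLaw ε pG) α (τ σ)) '' Set.Ici 0))
    (hattain : ∀ σ : ℝ, 0 < σ → ∃ α : ℝ, 0 ≤ α ∧
      mse q (mixLaw ε pG) α (τ σ) =
        sInf ((fun α : ℝ => mse q (mixLaw ε pG) α (τ σ)) '' Set.Ici 0)) :
    Tendsto
      (fun σ : ℝ =>
        (δ * ((τ σ) ^ 2 - σ ^ 2) - σ ^ 2 / (1 - 1 / δ)) / σ ^ 4)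
      (nhdsWithin 0 (Set.Ioi 0))
      (nhds (-(δ ^ 3 * ε * (q - 1) ^ 2 * (∫ x, |x| ^ (q - 2) ∂pG) ^ 2 /
        ((δ - 1) ^ 3 * ∫ x, |x| ^ (2 * q - 2) ∂pG)))) := by
  have hpB := isProbabilityMeasure_mixLaw (pG := pG) hε
  have hδ0 : 0 < δ := by linarith
  have hδ1 : 0 < δ - 1 := by linarith
  have hε0 := hε.1
  have hIB := integrable_mixLaw (ε := ε) hInt
  have hD := integral_mixLaw hε hInt (by
    rw [abs_zero, Real.zero_rpow (by linarith)])
  have hA := integral_mixLaw hε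
    (integrable_abs_rpow_of_le (r := q - 2) (by linarith) (by linarith) hInt) (by
      rw [abs_zero, Real.zero_rpow (by linarith)])
  have hσ : ∀ᶠ σ : ℝ in nhdsWithin 0 (Set.Ioi 0), 0 < σ := self_mem_nhdsWithin
  choose! α hα0 hα using hattain
  have hmin : ∀ σ, 0 < σ → ∀ β, 0 ≤ β →
      mse q (mixLaw ε pG) (α σ) (τ σ) ≤ mse q (mixLaw ε pG) β (τ σ) := fun σ hσ β hβ => by
    rw [hα σ hσ]
    refine csInf_le ⟨0, ?_⟩ ⟨β, hβ, rfl⟩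
    rintro _ ⟨γ, -, rfl⟩
    exact mse_nonneg _ _ _ _
  have hR : ∀ σ, 0 < σ → mse q (mixLaw ε pG) (α σ) (τ σ) = δ * (τ σ ^ 2 - σ ^ 2) :=
    fun σ hσ => by
      have := hfix σ hσ
      rw [← hα σ hσ] at this
      rw [this]
      field_simp
      ring
  have hτ : Tendsto τ (nhdsWithin 0 (Set.Ioi 0)) (nhds 0) := by
    have h1 : Tendsto (fun σ : ℝ => σ * √(δ / (δ - 1))) (nhdsWithin 0 (Set.Ioi 0)) (nhds 0) := by
      have : Tendsto (fun σ : ℝ => σ * √(δ / (δ - 1))) (nhds 0) (nhds (0 * √(δ / (δ - 1)))) :=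
        tendsto_id.mul_const _
      rw [zero_mul] at this
      exact this.mono_left nhdsWithin_le_nhds
    refine tendsto_of_tendsto_of_tendsto_of_le_of_le' tendsto_const_nhds h1
      (hσ.mono fun σ h => (hτpos σ h).le) (hσ.mono fun σ h => ?_)
    have h2 := hmin σ h 0 le_rfl
    rw [mse_zero hq, hR σ h] at h2
    refine abs_le_of_sq_le_sq' ?_ (by positivity) |>.2
    rw [mul_pow, Real.sq_sqrt (by positivity), mul_div_assoc', le_div_iff₀ hδ1]
    linarith
  have hL := tendsto_min_mse_sub_sq_div hq hIB (mixLaw_compl_zero_ne_zero hε hG0)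
    (by rw [hD]; positivity) (hσ.mono hτpos) hτ (hσ.mono hα0) (hσ.mono hmin)
  rw [hD, hA] at hL
  set L : ℝ → ℝ := fun σ => (mse q (mixLaw ε pG) (α σ) (τ σ) - τ σ ^ 2) / τ σ ^ 4 with hLdef
  have hden : Tendsto (fun σ => δ - 1 - L σ * τ σ ^ 2) (nhdsWithin 0 (Set.Ioi 0))
      (nhds (δ - 1)) := by
    simpa using (hL.mul (hτ.pow 2)).const_sub (δ - 1)
  have hlim := (hL.const_mul (δ / (δ - 1))).mul
    (((tendsto_const_nhds (x := δ)).div hden hδ1.ne').pow 2)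
  have hval : -(δ ^ 3 * ε * (q - 1) ^ 2 * (∫ x, |x| ^ (q - 2) ∂pG) ^ 2 /
        ((δ - 1) ^ 3 * ∫ x, |x| ^ (2 * q - 2) ∂pG)) =
      δ / (δ - 1) * -(((q - 1) * (ε * ∫ x, |x| ^ (q - 2) ∂pG)) ^ 2 /
        (ε * ∫ x, |x| ^ (2 * q - 2) ∂pG)) * (δ / (δ - 1)) ^ 2 := by
    field_simp
  rw [hval]
  refine hlim.congr' ?_
  filter_upwards [hσ, hden.eventually_const_lt hδ1] with σ h hpos'
  have hτσ := hτpos σ h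
  have hLσ : L σ * τ σ ^ 4 = δ * (τ σ ^ 2 - σ ^ 2) - τ σ ^ 2 := by
    simp only [hLdef]
    rw [div_mul_cancel₀ _ (by positivity), hR σ h]
  clear_value L
  have hratio : δ / (δ - 1 - L σ * τ σ ^ 2) = τ σ ^ 2 / σ ^ 2 := by
    rw [div_eq_div_iff hpos'.ne' (by positivity)]
    linarith
  have h1δ : 1 - 1 / δ = (δ - 1) / δ := by
    field_simp
  simp only [Pi.div_apply]
  rw [hratio, h1δ]
  field_simp
  linear_combination hLσ
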